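/- arXiv:2509.15914 — 3 statements merged into one kernel-verified Lean document; each statement's English description precedes it below -/
import Mathlib

section
/- Let L be a finite lattice, 𝓑 an L-building set, and X ∈ 𝓑. Then the restriction 𝓑_{|X} := {B ∈ 𝓑 : B ≤ X} is a building set of the interval lattice L_{≤X} = [⊥, X], and the contraction 𝓑_{/X} := {B ∨ X : B ∈ 𝓑, B ≰ X} is a building set of the interval lattice L_{≥X} = [X, ⊤]. -/
section LatticePrelims

variable {L : Type*} [Lattice L] [BoundedOrder L]

/-- The inclusion-maximal elements of `B` that lie below `Y`. -/
def maxBelow (B : Set L) (Y : L) : Set L :=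
  {X | X ∈ B ∧ X ≤ Y ∧ ∀ Z ∈ B, Z ≤ Y → X ≤ Z → X = Z}

/-- The interval below `Y` factors as the product of the intervals below the maximal elements
of `B` below `Y`, via an order isomorphism whose components are the interval inclusions. -/
def HasFactorization (B : Set L) (Y : L) : Prop :=
  ∃ φ : {t : maxBelow B Y → L // ∀ X, t X ≤ (X : L)} ≃o Set.Iic Y,
    ∀ (t : {t : maxBelow B Y → L // ∀ X, t X ≤ (X : L)}) (X : maxBelow B Y),
      (∀ X', X' ≠ X → t.val X' = ⊥) → (φ t : L) = t.val X

/-- `B` is a building set of the lattice `L` (Feichtner–Kozlov). -/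
def IsLatBuilding (B : Set L) : Prop :=
  (⊥ : L) ∉ B ∧ ∀ Y : L, ⊥ < Y → HasFactorization B Y

end LatticePrelims

section Factorization

variable {L : Type*} [Lattice L]

theorem exists_le_mem_maxBelow [Finite L] {B : Set L} {b Y : L} (hb : b ∈ B) (hbY : b ≤ Y) :
    ∃ m ∈ maxBelow B Y, b ≤ m := by
  obtain ⟨m, hbm, hm⟩ := (Set.toFinite {b | b ∈ B ∧ b ≤ Y}).exists_le_maximal ⟨hb, hbY⟩
  exact ⟨m, ⟨hm.1.1, hm.1.2, fun Z hZ hZY hmZ => hm.eq_of_le ⟨hZ, hZY⟩ hmZ⟩, hbm⟩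

theorem mem_maxBelow_restrict (B : Set L) (X : L) (Y m : Set.Iic X) :
    m ∈ maxBelow {Z : Set.Iic X | (Z : L) ∈ B} Y ↔ (m : L) ∈ maxBelow B (Y : L) := by
  constructor
  · rintro ⟨h₁, h₂, h₃⟩
    exact ⟨h₁, h₂, fun Z hZ hZY hmZ =>
      congrArg Subtype.val (h₃ ⟨Z, hZY.trans Y.2⟩ hZ hZY hmZ)⟩
  · rintro ⟨h₁, h₂, h₃⟩
    exact ⟨h₁, h₂, fun Z hZ hZY hmZ => Subtype.ext (h₃ Z hZ hZY hmZ)⟩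

variable [BoundedOrder L]

/-- The interval below `Y` factors over the maximal elements `m` of `B` below `Y` if and only if
`z ↦ (z ⊓ m)ₘ` is an order embedding that hits every tuple. -/
theorem hasFactorization_iff (B : Set L) (Y : L) :
    HasFactorization B Y ↔
      (∀ z ≤ Y, ∀ w ≤ Y, (∀ m ∈ maxBelow B Y, z ⊓ m ≤ w) → z ≤ w) ∧
      (∀ t : L → L, (∀ m ∈ maxBelow B Y, t m ≤ m) →
        ∃ s ≤ Y, ∀ m ∈ maxBelow B Y, s ⊓ m = t m) := by
  classical
  constructor
  · rintro ⟨φ, hφ⟩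
    have component_eq_inf : ∀ (z : Set.Iic Y) (m : maxBelow B Y),
        (φ.symm z).val m = (z : L) ⊓ m := by
      intro z m
      have key : ∀ a : L, a ≤ m → (a ≤ (φ.symm z).val m ↔ a ≤ (z : L)) := by
        intro a ha
        let t : {t : maxBelow B Y → L // ∀ X, t X ≤ (X : L)} :=
          ⟨fun X => if X = m then a else ⊥, fun X => by
            by_cases h : X = m
            · subst h; simpa using ha
            · simp [h]⟩
        have ht : (φ t : L) = a := by
          rw [hφ t m fun X' h => by simp [t, h]]
          simp [t]
        calc a ≤ (φ.symm z).val m ↔ t ≤ φ.symm z := by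
              refine ⟨fun h X => ?_, fun h => ?_⟩
              · by_cases hX : X = m
                · subst hX; simpa [t] using h
                · simp [t, hX]
              · simpa [t] using h m
          _ ↔ φ t ≤ z := φ.le_symm_apply
          _ ↔ a ≤ (z : L) := by rw [← Subtype.coe_le_coe, ht]
      have hm := (φ.symm z).prop m
      exact le_antisymm (le_inf ((key _ hm).1 le_rfl) hm) ((key _ inf_le_right).2 inf_le_left)
    refine ⟨fun z hz w hw h => ?_, fun t ht => ?_⟩
    · have : φ.symm ⟨z, hz⟩ ≤ φ.symm ⟨w, hw⟩ := by
        intro m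
        change (φ.symm ⟨z, hz⟩).val m ≤ (φ.symm ⟨w, hw⟩).val m
        rw [component_eq_inf, component_eq_inf]
        exact le_inf (h m m.2) inf_le_right
      exact φ.symm.le_iff_le.1 this
    · let t' : {t : maxBelow B Y → L // ∀ X, t X ≤ (X : L)} := ⟨fun m => t m, fun m => ht m m.2⟩
      refine ⟨φ t', (φ t').2, fun m hm => ?_⟩
      rw [← component_eq_inf (φ t') ⟨m, hm⟩, φ.symm_apply_apply]
  · rintro ⟨hinj, hsurj⟩
    have disjoint_of_ne : ∀ m ∈ maxBelow B Y, ∀ m' ∈ maxBelow B Y, m' ≠ m → m ⊓ m' ≤ ⊥ := by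
      intro m hm m' hm' hne
      obtain ⟨s, -, hs⟩ := hsurj (fun x => if x = m then m else ⊥) fun x _ => by
        by_cases h : x = m <;> simp [h]
      have h₁ : s ⊓ m = m := by simpa using hs m hm
      have h₂ : s ⊓ m' = ⊥ := by simpa [hne] using hs m' hm'
      rw [← h₂]
      exact inf_le_inf_right _ (inf_eq_right.1 h₁)
    let f : Set.Iic Y → {t : maxBelow B Y → L // ∀ X, t X ≤ (X : L)} :=
      fun z => ⟨fun m => z ⊓ m, fun m => inf_le_right⟩
    have hf : ∀ z w, f z ≤ f w ↔ z ≤ w := by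
      refine fun z w => ⟨fun h => hinj z z.2 w w.2 fun m hm => (h ⟨m, hm⟩).trans inf_le_left,
        fun h m => inf_le_inf_right _ h⟩
    have hf_surj : Function.Surjective f := by
      intro t
      obtain ⟨s, hsY, hs⟩ := hsurj (fun x => if h : x ∈ maxBelow B Y then t.val ⟨x, h⟩ else ⊥)
        fun x hx => by simpa [hx] using t.2 ⟨x, hx⟩
      refine ⟨⟨s, hsY⟩, Subtype.ext (funext fun m => ?_)⟩
      simpa using hs m m.2
    let e := OrderIso.ofSurjective (OrderEmbedding.ofMapLEIff f hf) hf_surj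
    refine ⟨e.symm, fun t m ht => ?_⟩
    have hmY : t.val m ≤ Y := (t.2 m).trans m.2.2.1
    suffices e.symm t = ⟨t.val m, hmY⟩ by rw [this]
    rw [OrderIso.symm_apply_eq]
    refine Subtype.ext (funext fun m' => ?_)
    change t.val m' = t.val m ⊓ m'
    by_cases h : m' = m
    · subst h; exact (inf_eq_left.2 (t.2 _)).symm
    · rw [ht m' h, eq_comm, ← le_bot_iff]
      exact (inf_le_inf_right _ (t.2 m)).trans
        (disjoint_of_ne m m.2 m' m'.2 fun h' => h (Subtype.ext h'))

theorem IsLatBuilding.restrict {B : Set L} (hB : IsLatBuilding B) (X : L) :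
    IsLatBuilding {Z : Set.Iic X | (Z : L) ∈ B} := by
  classical
  refine ⟨hB.1, fun Y hY => ?_⟩
  obtain ⟨hinj, hsurj⟩ := (hasFactorization_iff B (Y : L)).1 (hB.2 Y hY)
  have le_X : ∀ {m}, m ∈ maxBelow B (Y : L) → m ≤ X := fun hm => hm.2.1.trans Y.2
  rw [hasFactorization_iff]
  refine ⟨fun z hz w hw h => hinj z hz w hw fun m hm =>
    h ⟨m, le_X hm⟩ ((mem_maxBelow_restrict B X Y _).2 hm), fun t ht => ?_⟩
  obtain ⟨s, hsY, hs⟩ := hsurj (fun x => if h : x ≤ X then (t ⟨x, h⟩ : L) else ⊥) fun m hm => by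
    rw [dif_pos (le_X hm)]
    exact ht ⟨m, le_X hm⟩ ((mem_maxBelow_restrict B X Y _).2 hm)
  refine ⟨⟨s, hsY.trans Y.2⟩, hsY, fun m hm => Subtype.ext ?_⟩
  have hmX : (m : L) ≤ X := m.2
  simpa [hmX] using hs m ((mem_maxBelow_restrict B X Y m).1 hm)

theorem IsLatBuilding.contract [Finite L] {B : Set L} (hB : IsLatBuilding B) {X : L}
    (hX : X ∈ B) :
    IsLatBuilding {Z : Set.Ici X | ∃ b ∈ B, ¬ b ≤ X ∧ (Z : L) = b ⊔ X} := by
  classical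
  refine ⟨fun ⟨b, _, hbX, hb⟩ => hbX ?_, fun Y hY => ?_⟩
  · change X = b ⊔ X at hb
    exact hb ▸ le_sup_left
  have hXY : X ≤ (Y : L) := Y.2
  have hX_pos : ⊥ < X := bot_lt_iff_ne_bot.2 fun h => hB.1 (h ▸ hX)
  obtain ⟨hinj, hsurj⟩ := (hasFactorization_iff B (Y : L)).1 (hB.2 Y (hX_pos.trans_le hXY))
  obtain ⟨m₀, hm₀, hXm₀⟩ := exists_le_mem_maxBelow hX hXY
  have sup_inf_le : ∀ m ∈ maxBelow B (Y : L), m ≠ m₀ →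
      (m ⊔ X) ⊓ m₀ ≤ X ∧
        ∀ m' ∈ maxBelow B (Y : L), m' ≠ m₀ → m' ≠ m → (m ⊔ X) ⊓ m' ≤ ⊥ := by
    intro m hm hne
    obtain ⟨s, -, hs⟩ := hsurj (fun x => if x = m then m else if x = m₀ then X else ⊥) fun x _ => by
      split_ifs with h₁ h₂
      · exact h₁.ge
      · exact h₂ ▸ hXm₀
      · exact bot_le
    have h₁ : s ⊓ m = m := by simpa using hs m hm
    have h₀ : s ⊓ m₀ = X := by simpa [hne.symm] using hs m₀ hm₀
    have hle : m ⊔ X ≤ s := sup_le (inf_eq_right.1 h₁) (h₀ ▸ inf_le_left)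
    refine ⟨(inf_le_inf_right _ hle).trans h₀.le, fun m' hm' h h' => ?_⟩
    have h₂ : s ⊓ m' = ⊥ := by simpa [h, h'] using hs m' hm'
    exact (inf_le_inf_right _ hle).trans h₂.le
  have sup_mem : ∀ m ∈ maxBelow B (Y : L), ¬ m ≤ X →
      (⟨m ⊔ X, le_sup_right⟩ : Set.Ici X) ∈
        maxBelow {Z : Set.Ici X | ∃ b ∈ B, ¬ b ≤ X ∧ (Z : L) = b ⊔ X} Y := by
    intro m hm hmX
    refine ⟨⟨m, hm.1, hmX, rfl⟩, sup_le hm.2.1 hXY, ?_⟩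
    rintro ⟨Z, hXZ⟩ ⟨b, hb, -, rfl : Z = b ⊔ X⟩ hZY hmZ
    change b ⊔ X ≤ (Y : L) at hZY
    change m ⊔ X ≤ b ⊔ X at hmZ
    obtain ⟨m', hm', hbm'⟩ := exists_le_mem_maxBelow hb (le_sup_left.trans hZY)
    have hmm' : m ≤ m' ⊔ X := le_sup_left.trans (hmZ.trans (sup_le_sup_right hbm' X))
    suffices m = m' by
      subst this
      exact Subtype.ext (le_antisymm hmZ (sup_le_sup_right hbm' X))
    by_cases h' : m' = m₀
    · subst h'
      exact hm.2.2 _ hm'.1 hm'.2.1 (hmm'.trans (sup_le le_rfl hXm₀))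
    · obtain ⟨h₁, h₂⟩ := sup_inf_le m' hm' h'
      by_cases h : m = m₀
      · subst h
        exact absurd ((le_inf hmm' le_rfl).trans h₁) hmX
      · by_contra hne
        exact hB.1 (le_bot_iff.1 ((le_inf hmm' le_rfl).trans (h₂ m hm h hne)) ▸ hm.1)
  have exists_eq_sup : ∀ Z ∈ maxBelow {Z : Set.Ici X | ∃ b ∈ B, ¬ b ≤ X ∧ (Z : L) = b ⊔ X} Y,
      ∃ m ∈ maxBelow B (Y : L), ¬ m ≤ X ∧ Z = ⟨m ⊔ X, le_sup_right⟩ := by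
    rintro ⟨Z, hXZ⟩ ⟨⟨b, hb, hbX, rfl : Z = b ⊔ X⟩, hZY, hmax⟩
    change b ⊔ X ≤ (Y : L) at hZY
    obtain ⟨m, hm, hbm⟩ := exists_le_mem_maxBelow hb (le_sup_left.trans hZY)
    have hmX : ¬ m ≤ X := fun h => hbX (hbm.trans h)
    exact ⟨m, hm, hmX, hmax _ ⟨m, hm.1, hmX, rfl⟩ (sup_le hm.2.1 hXY)
      (sup_le_sup_right hbm X : b ⊔ X ≤ m ⊔ X)⟩
  rw [hasFactorization_iff]
  refine ⟨fun z hz w hw h => hinj z hz w hw fun m hm => ?_, fun t ht => ?_⟩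
  · by_cases hmX : m ≤ X
    · exact inf_le_right.trans (hmX.trans w.2)
    · have : (z : L) ⊓ (m ⊔ X) ≤ w := h _ (sup_mem m hm hmX)
      exact (inf_le_inf_left _ le_sup_left).trans this
  · have t_le : ∀ m ∈ maxBelow B (Y : L), ¬ m ≤ X →
        (t ⟨m ⊔ X, le_sup_right⟩ : L) ≤ m ⊔ X := fun m hm hmX => ht _ (sup_mem m hm hmX)
    have le_t : ∀ Z, X ≤ (t Z : L) := fun Z => (t Z).2
    obtain ⟨s, hsY, hs⟩ := hsurj
      (fun m => if m ≤ X then m else (t ⟨m ⊔ X, le_sup_right⟩ : L) ⊓ m) fun m hm => by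
        split_ifs
        · exact le_rfl
        · exact inf_le_right
    have hs_inf : ∀ m ∈ maxBelow B (Y : L), ¬ m ≤ X →
        s ⊓ m = (t ⟨m ⊔ X, le_sup_right⟩ : L) ⊓ m := fun m hm hmX => by
      simpa [hmX] using hs m hm
    have hXs : X ≤ s := by
      by_cases h : m₀ ≤ X
      · have : s ⊓ m₀ = m₀ := by simpa [h] using hs m₀ hm₀
        exact hXm₀.trans (inf_eq_right.1 this)
      · exact (le_inf (le_t _) hXm₀).trans ((hs_inf m₀ hm₀ h).ge.trans inf_le_left)
    refine ⟨⟨s, hXs⟩, hsY, fun Z hZ => ?_⟩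
    obtain ⟨m, hm, hmX, rfl⟩ := exists_eq_sup Z hZ
    refine Subtype.ext ?_
    change s ⊓ (m ⊔ X) = (t ⟨m ⊔ X, le_sup_right⟩ : L)
    have htm := t_le m hm hmX
    have hsm := hs_inf m hm hmX
    have hXt := le_t ⟨m ⊔ X, le_sup_right⟩
    generalize (t ⟨m ⊔ X, le_sup_right⟩ : L) = a at htm hsm hXt
    by_cases hne : m = m₀
    · subst hne
      rw [sup_eq_left.2 hXm₀] at htm ⊢
      rw [hsm, inf_eq_left.2 htm]
    · obtain ⟨h₁, h₂⟩ := sup_inf_le m hm hne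
      have hmY : m ⊔ X ≤ (Y : L) := sup_le hm.2.1 hXY
      have le_of_inf_le : ∀ p ≤ m ⊔ X, ∀ q ≤ m ⊔ X, X ≤ q → p ⊓ m ≤ q → p ≤ q := by
        intro p hp q hq hXq hpq
        refine hinj p (hp.trans hmY) q (hq.trans hmY) fun m' hm' => ?_
        by_cases h : m' = m₀
        · subst h
          exact (inf_le_inf_right _ hp).trans (h₁.trans hXq)
        · by_cases h' : m' = m
          · exact h' ▸ hpq
          · exact (inf_le_inf_right _ hp).trans ((h₂ m' hm' h h').trans bot_le)
      apply le_antisymm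
      · refine le_of_inf_le _ inf_le_right _ htm hXt ?_
        exact (inf_le_inf_right _ inf_le_left).trans (hsm.le.trans inf_le_left)
      · refine le_of_inf_le _ htm _ inf_le_right (le_inf hXs le_sup_right) ?_
        exact le_inf (hsm.ge.trans inf_le_left) (inf_le_right.trans le_sup_left)

end Factorization

/-- **Restriction and contraction of building sets.** If `B` is a building set of a finite
lattice `L` and `X ∈ B`, then the restriction `B_{|X} = {b ∈ B : b ≤ X}` is a building set of
the interval lattice `[⊥, X]`, and the contraction `B_{/X} = {b ⊔ X : b ∈ B, b ≰ X}` is a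
building set of the interval lattice `[X, ⊤]`. -/
theorem building_restriction_contraction {L : Type*} [Lattice L] [BoundedOrder L] [Fintype L]
    (B : Set L) (hB : IsLatBuilding B) (X : L) (hX : X ∈ B) :
    IsLatBuilding {Z : Set.Iic X | (Z : L) ∈ B} ∧
    IsLatBuilding {Z : Set.Ici X | ∃ b ∈ B, ¬ b ≤ X ∧ (Z : L) = b ⊔ X} :=
  ⟨hB.restrict X, hB.contract hX⟩
end

section
/- Let L be a finite atomic lattice with set of atoms S, let φ(X) = {s ∈ S : s ≤ X} for X ∈ L, let 𝓑 be an L-building set, and let 𝓑' be the building closure of {φ(B) : B ∈ 𝓑} on S. Then for every L-nested set N on 𝓑, the set {φ(B) : B ∈ N∖𝓒(𝓑)} ∪ 𝓒(𝓑') is a nested set on the building set 𝓑'. Since φ is injective, this exhibits the L-nested complex of 𝓑 as isomorphic to a subcomplex of the boolean nested complex of 𝓑'. -/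
section LatticePrelims

variable {L : Type*} [Lattice L] [BoundedOrder L]

/-- The connected components (i.e. the inclusion-maximal elements) of `B`. -/
def latConn (B : Set L) : Set L :=
  {X | X ∈ B ∧ ∀ Z ∈ B, X ≤ Z → X = Z}

/-- `N` is an `L`-nested set on the building set `B`. -/
def IsLatNested (B N : Set L) : Prop :=
  N ⊆ B ∧ latConn B ⊆ N ∧
    ∀ A : Finset L, ↑A ⊆ N \ latConn B → 2 ≤ A.card →
      (↑A : Set L).Pairwise (fun x y => ¬ x ≤ y ∧ ¬ y ≤ x) → A.sup id ∉ B

/-- The set of atoms of `L` lying below `X`. -/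
def atomsBelow (X : L) : Set {a : L // IsAtom a} :=
  {s | (s : L) ≤ X}

end LatticePrelims

/-- A (boolean) building set on the ground set `S`. -/
def IsBoolBuilding {S : Type*} (C : Set (Set S)) : Prop :=
  (∀ c ∈ C, c.Nonempty) ∧ (∀ s : S, {s} ∈ C) ∧
    ∀ c ∈ C, ∀ d ∈ C, (c ∩ d).Nonempty → c ∪ d ∈ C

/-- The connected components (inclusion-maximal members) of a family of subsets of `S`. -/
def boolConn {S : Type*} (C : Set (Set S)) : Set (Set S) :=
  {c | c ∈ C ∧ ∀ d ∈ C, c ⊆ d → c = d}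

/-- A (boolean) nested set on a building set `C` on `S`: a subset of `C` containing the
connected components of `C`, whose members are pairwise nested or disjoint, and such that the
union of `k ≥ 2` pairwise disjoint members never belongs to `C`. -/
def IsBoolNested {S : Type*} (C N : Set (Set S)) : Prop :=
  N ⊆ C ∧ boolConn C ⊆ N ∧
    (∀ c ∈ N, ∀ d ∈ N, c ⊆ d ∨ d ⊆ c ∨ c ∩ d = ∅) ∧
    ∀ A : Finset (Set S), ↑A ⊆ N → 2 ≤ A.card →
      (↑A : Set (Set S)).Pairwise (fun c d => c ∩ d = ∅) → A.sup id ∉ C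

/-- Every member of `B` below `Y` lies below a maximal one. -/
theorem exists_le_mem_maxBelow_s9 {L : Type*} [Lattice L] [Finite L] {B : Set L} {Y Z : L}
    (hZ : Z ∈ B) (hZY : Z ≤ Y) : ∃ X ∈ maxBelow B Y, Z ≤ X := by
  obtain ⟨X, hZX, hX⟩ :=
    (Set.toFinite {W | W ∈ B ∧ W ≤ Y}).exists_le_maximal (a := Z) ⟨hZ, hZY⟩
  exact ⟨X, ⟨hX.prop.1, hX.prop.2, fun W hW hWY hXW => hX.eq_of_le ⟨hW, hWY⟩ hXW⟩, hZX⟩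

section LatticeBuilding

variable {L : Type*} [Lattice L] [BoundedOrder L] {B : Set L}

/-- Distinct factors of an interval meet only in `⊥`. -/
theorem HasFactorization.eq_of_le_of_le {Y X X' a : L} (h : HasFactorization B Y)
    (hX : X ∈ maxBelow B Y) (hX' : X' ∈ maxBelow B Y) (haX : a ≤ X) (haX' : a ≤ X')
    (ha : a ≠ ⊥) : X = X' := by
  classical
  obtain ⟨φ, hφ⟩ := h
  by_contra hne
  let single (Z : maxBelow B Y) (hZ : a ≤ (Z : L)) :
      {t : maxBelow B Y → L // ∀ X, t X ≤ (X : L)} :=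
    ⟨fun W => if W = Z then a else ⊥, fun W => by
      by_cases hW : W = Z
      · simpa [hW] using hZ
      · simp [hW]⟩
  have key (Z : maxBelow B Y) (hZ : a ≤ (Z : L)) : (φ (single Z hZ) : L) = a := by
    rw [hφ (single Z hZ) Z fun W hW => if_neg hW]
    exact if_pos rfl
  have heq : single ⟨X, hX⟩ haX = single ⟨X', hX'⟩ haX' :=
    φ.injective (Subtype.ext ((key _ haX).trans (key _ haX').symm))
  have hval := congrFun (congrArg Subtype.val heq) ⟨X, hX⟩
  simp [single, hne] at hval
  exact ha hval

theorem IsLatBuilding.ne_bot (hB : IsLatBuilding B) {b : L} (hb : b ∈ B) : b ≠ ⊥ :=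
  fun h => hB.1 (h ▸ hb)

theorem IsLatBuilding.atom_mem (hB : IsLatBuilding B) {a : L} (ha : IsAtom a) : a ∈ B := by
  obtain ⟨φ, -⟩ := hB.2 a ha.bot_lt
  rcases isEmpty_or_nonempty (maxBelow B a) with hempty | ⟨X, hX, hXa, -⟩
  · have heq : (⟨⊥, bot_le⟩ : Set.Iic a) = ⟨a, le_rfl⟩ :=
      φ.symm.injective (Subtype.ext (Subsingleton.elim _ _))
    exact absurd (congrArg Subtype.val heq).symm ha.1
  · exact (ha.le_iff.1 hXa).resolve_left (hB.ne_bot hX) ▸ hX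

/-- A building set is closed under joins of elements with a common nonzero lower bound. -/
theorem IsLatBuilding.sup_mem [Finite L] (hB : IsLatBuilding B) {x y a : L} (hx : x ∈ B)
    (hy : y ∈ B) (hax : a ≤ x) (hay : a ≤ y) (ha : a ≠ ⊥) : x ⊔ y ∈ B := by
  have hpos : ⊥ < x ⊔ y := (bot_lt_iff_ne_bot.2 ha).trans_le (hax.trans le_sup_left)
  obtain ⟨X, hX, hxX⟩ := exists_le_mem_maxBelow_s9 hx (le_sup_left : x ≤ x ⊔ y)
  obtain ⟨X', hX', hyX'⟩ := exists_le_mem_maxBelow_s9 hy (le_sup_right : y ≤ x ⊔ y)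
  obtain rfl := (hB.2 _ hpos).eq_of_le_of_le hX hX' (hax.trans hxX) (hay.trans hyX') ha
  rw [le_antisymm (sup_le hxX hyX') hX.2.1]
  exact hX.1

theorem isLUB_atomsBelow
    (hatomic : ∀ X : L, ∃ A : Finset L, (∀ a ∈ A, IsAtom a) ∧ X = A.sup id) (X : L) :
    IsLUB (Subtype.val '' atomsBelow X) X := by
  refine ⟨?_, fun u hu => ?_⟩
  · rintro _ ⟨s, hs, rfl⟩
    exact hs
  · obtain ⟨A, hA, hXA⟩ := hatomic X
    rw [hXA]
    refine Finset.sup_le fun a ha => hu ⟨⟨a, hA a ha⟩, ?_, rfl⟩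
    change a ≤ X
    exact hXA ▸ Finset.le_sup (f := id) ha

theorem atomsBelow_mono {x y : L} (h : x ≤ y) : atomsBelow x ⊆ atomsBelow y :=
  fun _ hs => le_trans hs h

/-- The nonempty sets of atoms whose join lies in `B` form a boolean building set. -/
theorem IsLatBuilding.isBoolBuilding_lub_mem [Finite L] (hB : IsLatBuilding B) :
    IsBoolBuilding {c : Set {a : L // IsAtom a} |
      c.Nonempty ∧ ∃ b ∈ B, IsLUB (Subtype.val '' c) b} := by
  refine ⟨fun c hc => hc.1, fun s => ?_, ?_⟩
  · exact ⟨Set.singleton_nonempty s, s, hB.atom_mem s.2, by simp⟩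
  · rintro c ⟨hc, x, hx, hcx⟩ d ⟨-, y, hy, hdy⟩ ⟨s, hsc, hsd⟩
    refine ⟨hc.mono Set.subset_union_left, x ⊔ y, ?_, ?_⟩
    · exact hB.sup_mem hx hy (hcx.1 ⟨s, hsc, rfl⟩) (hdy.1 ⟨s, hsd, rfl⟩) s.2.1
    · rw [Set.image_union]
      exact hcx.union hdy

/-- Non-maximal members of a nested set with a common nonzero lower bound are comparable. -/
theorem IsLatNested.le_or_le [Finite L] {N : Set L} (hN : IsLatNested B N)
    (hB : IsLatBuilding B) {x y a : L} (hx : x ∈ N \ latConn B) (hy : y ∈ N \ latConn B)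
    (hax : a ≤ x) (hay : a ≤ y) (ha : a ≠ ⊥) : x ≤ y ∨ y ≤ x := by
  classical
  by_contra! h
  have hne : x ≠ y := fun e => h.1 e.le
  refine hN.2.2 {x, y} ?_ (Finset.card_pair hne).ge ?_ ?_
  · simp [Set.insert_subset_iff, hx, hy]
  · rw [Finset.coe_pair, Set.pairwise_pair]
    exact fun _ => ⟨h, h.symm⟩
  · simpa using hB.sup_mem (hN.1 hx.1) (hN.1 hy.1) hax hay ha

end LatticeBuilding

/-- A member of a boolean building set meeting a connected component is contained in it. -/
theorem IsBoolBuilding.subset_of_mem_boolConn {S : Type*} {C : Set (Set S)}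
    (hC : IsBoolBuilding C) {c d : Set S} (hc : c ∈ boolConn C) (hd : d ∈ C)
    (h : (c ∩ d).Nonempty) : d ⊆ c := by
  rw [hc.2 _ (hC.2.2 c hc.1 d hd h) Set.subset_union_left]
  exact Set.subset_union_right

/-- **Atomic nested complexes embed into boolean nested complexes.** For a finite atomic
lattice `L` with set of atoms `S` and `φ : X ↦ {s ∈ S : s ≤ X}`, any `L`-building set `B`, and
`C` the building closure on `S` of `{φ b : b ∈ B}`, the image of every `L`-nested set `N` on
`B` is again nested: the set `{φ b : b ∈ N ∖ latConn B} ∪ boolConn C` is a nested set on the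
building set `C`. -/
theorem atomic_nested_embeds_boolean {L : Type*} [Lattice L] [BoundedOrder L] [Fintype L]
    (hatomic : ∀ X : L, ∃ A : Finset L, (∀ a ∈ A, IsAtom a) ∧ X = A.sup id)
    (B : Set L) (hB : IsLatBuilding B)
    (C : Set (Set {a : L // IsAtom a}))
    (hC : IsBoolBuilding C) (hBC : ∀ b ∈ B, atomsBelow b ∈ C)
    (hCmin : ∀ D : Set (Set {a : L // IsAtom a}),
      IsBoolBuilding D → (∀ b ∈ B, atomsBelow b ∈ D) → C ⊆ D) :
    ∀ N : Set L, IsLatNested B N →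
      IsBoolNested C ((fun b => atomsBelow b) '' (N \ latConn B) ∪ boolConn C) := by
  classical
  intro N hN
  have hlub := isLUB_atomsBelow hatomic
  have hCsub := hCmin _ hB.isBoolBuilding_lub_mem
    fun b hb => ⟨hC.1 _ (hBC b hb), b, hb, hlub b⟩
  have hsub : (fun b => atomsBelow b) '' (N \ latConn B) ∪ boolConn C ⊆ C := by
    rintro _ (⟨b, hb, rfl⟩ | hc)
    exacts [hBC b (hN.1 hb.1), hc.1]
  refine ⟨hsub, Set.subset_union_right, fun c hc d hd => ?_, fun A hA hcard hdisj hmem => ?_⟩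
  · rcases Set.eq_empty_or_nonempty (c ∩ d) with hcd | hcd
    · exact Or.inr (Or.inr hcd)
    · rcases hc with ⟨x, hx, rfl⟩ | hc'
      · rcases hd with ⟨y, hy, rfl⟩ | hd'
        · obtain ⟨s, hsx, hsy⟩ := hcd
          rcases hN.le_or_le hB hx hy hsx hsy s.2.1 with h | h
          exacts [Or.inl (atomsBelow_mono h), Or.inr (Or.inl (atomsBelow_mono h))]
        · refine Or.inl (hC.subset_of_mem_boolConn hd' (hsub (Or.inl ⟨x, hx, rfl⟩)) ?_)
          rwa [Set.inter_comm]
      · exact Or.inr (Or.inl (hC.subset_of_mem_boolConn hc' (hsub hd) hcd))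
  · have hA_le : ∀ c ∈ A, c ⊆ A.sup id := fun c hc => Finset.le_sup (f := id) hc
    have hA_conn : ∀ c ∈ A, c ∉ boolConn C := by
      intro c hc hconn
      obtain ⟨d, hd, hne⟩ := Finset.exists_mem_ne hcard c
      obtain ⟨s, hs⟩ := hC.1 d (hsub (hA hd))
      have hsc : s ∈ c := by
        rw [hconn.2 _ hmem (hA_le c hc)]
        exact hA_le d hd hs
      exact (hdisj hd hc hne).subset ⟨hs, hsc⟩
    let A' : Finset L := Finset.univ.filter fun b => b ∈ N \ latConn B ∧ atomsBelow b ∈ A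
    have hA' : ∀ b, b ∈ A' ↔ b ∈ N \ latConn B ∧ atomsBelow b ∈ A := by simp [A']
    have hlift : ∀ c ∈ A, ∃ b ∈ A', atomsBelow b = c := by
      intro c hc
      obtain ⟨b, hb, rfl⟩ := (hA hc).resolve_right (hA_conn c hc)
      exact ⟨b, (hA' b).2 ⟨hb, hc⟩, rfl⟩
    have hcard' : 2 ≤ A'.card :=
      hcard.trans (Finset.card_le_card_of_surjOn atomsBelow fun c hc => hlift c hc)
    have hincomp : ∀ x ∈ A', ∀ y ∈ A', x ≠ y → ¬ x ≤ y := by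
      intro x hx y hy hne hle
      obtain ⟨hxN, hxA⟩ := (hA' x).1 hx
      obtain ⟨s, hs⟩ := hC.1 _ (hBC x (hN.1 hxN.1))
      have hne' : atomsBelow x ≠ atomsBelow y := by
        intro h
        have hx_lub := hlub x
        rw [h] at hx_lub
        exact hne (hx_lub.unique (hlub y))
      exact (hdisj hxA ((hA' y).1 hy).2 hne').subset ⟨hs, atomsBelow_mono hle hs⟩
    obtain ⟨-, b, hb, hb_lub⟩ := hCsub hmem
    have hsup : A'.sup id = b := by
      apply le_antisymm
      · refine Finset.sup_le fun x hx => (hlub x).2 ?_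
        exact upperBounds_mono_set (Set.image_mono (hA_le _ ((hA' x).1 hx).2)) hb_lub.1
      · refine hb_lub.2 ?_
        rintro _ ⟨s, hs, rfl⟩
        rw [Finset.sup_id_set_eq_sUnion] at hs
        obtain ⟨c, hc, hsc⟩ := hs
        obtain ⟨x, hx, rfl⟩ := hlift c hc
        exact le_trans hsc (Finset.le_sup (f := id) hx)
    refine hN.2.2 A' (fun x hx => ((hA' x).1 hx).1) hcard' ?_ (hsup ▸ hb)
    exact fun x hx y hy hne => ⟨hincomp x hx y hy hne, hincomp y hy x hx hne.symm⟩
end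

section
/- Let E be a finite-dimensional real inner product space, A = (a_s)_{s∈S} a finite acyclic family of vectors of E, and 𝓑 an oriented building set for A. Then 𝓕 := {B ∈ 𝓑 : B is a face of A} is a facial building set for A; that is, for every nonempty face F of A, writing {F₁, …, F_k} for the inclusion-maximal elements of {G ∈ 𝓕 : G ⊆ F}, there is an order isomorphism from the product of the posets {faces of A contained in F_j} (each ordered by inclusion) onto the poset {faces of A contained in F} (ordered by inclusion) whose j-th component is the inclusion. -/
/-- `F` is a face of the family of vectors `A`: some linear functional vanishes on
`{A s : s ∈ F}` and is positive on the remaining vectors of the family. -/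
def IsFaceOf {S E : Type*} [AddCommGroup E] [Module ℝ E] (A : S → E) (F : Set S) : Prop :=
  ∃ f : E →ₗ[ℝ] ℝ, (∀ s ∈ F, f (A s) = 0) ∧ ∀ s ∉ F, 0 < f (A s)

/-- `c` is the support of a support-minimal nonzero linear dependence of the family `A`. -/
def IsCircuitSupport {S E : Type*} [Fintype S] [AddCommGroup E] [Module ℝ E]
    (A : S → E) (c : Set S) : Prop :=
  ∃ δ : S → ℝ, δ ≠ 0 ∧ ∑ s, δ s • A s = 0 ∧ c = {s | δ s ≠ 0} ∧
    ∀ δ' : S → ℝ, δ' ≠ 0 → ∑ s, δ' s • A s = 0 →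
      {s | δ' s ≠ 0} ⊆ {s | δ s ≠ 0} → {s | δ' s ≠ 0} = {s | δ s ≠ 0}

/-- An oriented building set for the family `A`: a building set on `S` containing all the
circuit supports of `A`. -/
def IsOrientedBuilding {S E : Type*} [Fintype S] [AddCommGroup E] [Module ℝ E]
    (A : S → E) (B : Set (Set S)) : Prop :=
  IsBoolBuilding B ∧ ∀ c : Set S, IsCircuitSupport A c → c ∈ B

/-- The smallest face of `A` containing `X`: the intersection of all faces of `A`
containing `X`. -/
def faceClosure {S E : Type*} [AddCommGroup E] [Module ℝ E] (A : S → E) (X : Set S) : Set S :=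
  ⋂₀ {F | IsFaceOf A F ∧ X ⊆ F}

/-- The inclusion-maximal elements of `𝓕` contained in `F`. -/
def facialMaxBelow {S : Type*} (𝓕 : Set (Set S)) (F : Set S) : Set (Set S) :=
  {G | G ∈ 𝓕 ∧ G ⊆ F ∧ ∀ H ∈ 𝓕, H ⊆ F → G ⊆ H → G = H}

/-- `𝓕` is a facial building set for the family `A`: a collection of nonempty faces of `A`
such that for every nonempty face `F` of `A`, the poset of faces of `A` contained in `F` is
the product of the posets of faces contained in the inclusion-maximal elements of `𝓕` below
`F`, via an order isomorphism whose components are the inclusions (i.e. it sends every tuple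
that is `∅` away from the coordinate `G` to its `G`-th entry). -/
def IsFacialBuilding {S E : Type*} [AddCommGroup E] [Module ℝ E]
    (A : S → E) (𝓕 : Set (Set S)) : Prop :=
  (∀ G ∈ 𝓕, IsFaceOf A G ∧ G.Nonempty) ∧
  ∀ F : Set S, IsFaceOf A F → F.Nonempty →
    ∃ φ : {t : facialMaxBelow 𝓕 F → Set S // ∀ G, IsFaceOf A (t G) ∧ t G ⊆ (G : Set S)} ≃o
          {H : Set S // IsFaceOf A H ∧ H ⊆ F},
      ∀ (t : {t : facialMaxBelow 𝓕 F → Set S // ∀ G, IsFaceOf A (t G) ∧ t G ⊆ (G : Set S)})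
        (G : facialMaxBelow 𝓕 F),
        (∀ G', G' ≠ G → t.val G' = ∅) → (φ t : Set S) = t.val G

/-- A nonzero linear dependence contains a support-minimal one in its support. -/
lemma exists_circuit_of_dependence {S E : Type*} [Fintype S] [AddCommGroup E] [Module ℝ E]
    (A : S → E) (δ : S → ℝ) (hδ : δ ≠ 0) (hA : ∑ s, δ s • A s = 0) :
    ∃ γ : S → ℝ, γ ≠ 0 ∧ ∑ s, γ s • A s = 0 ∧ {s | γ s ≠ 0} ⊆ {s | δ s ≠ 0} ∧
      IsCircuitSupport A {s | γ s ≠ 0} := by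
  obtain ⟨c, hcδ, hc⟩ := (Set.toFinite {c : Set S | ∃ γ : S → ℝ, γ ≠ 0 ∧
    ∑ s, γ s • A s = 0 ∧ c = {s | γ s ≠ 0}}).exists_le_minimal ⟨δ, hδ, hA, rfl⟩
  obtain ⟨γ, hγ, hγA, rfl⟩ := hc.1
  exact ⟨γ, hγ, hγA, hcδ, γ, hγ, hγA, rfl, fun γ' h0 hA' hsub =>
    hsub.antisymm (hc.2 ⟨γ', h0, hA', rfl⟩ hsub)⟩

/-- A weight orthogonal to every dependence supported on a circuit inside `F` is orthogonal to
every dependence supported inside `F`. -/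
lemma sum_mul_eq_zero_of_circuits {S E : Type*} [Fintype S] [AddCommGroup E] [Module ℝ E]
    (A : S → E) (F : Set S) (w : S → ℝ)
    (hw : ∀ γ : S → ℝ, ∑ s, γ s • A s = 0 → {s | γ s ≠ 0} ⊆ F →
      IsCircuitSupport A {s | γ s ≠ 0} → ∑ s, γ s * w s = 0)
    (δ : S → ℝ) (hδ : ∑ s, δ s • A s = 0) (hF : {s | δ s ≠ 0} ⊆ F) :
    ∑ s, δ s * w s = 0 := by
  induction hn : {s | δ s ≠ 0}.ncard using Nat.strong_induction_on generalizing δ with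
  | _ n ih =>
    by_cases h0 : δ = 0
    · simp [h0]
    obtain ⟨γ, hγ, hγA, hsub, hc⟩ := exists_circuit_of_dependence A δ h0 hδ
    obtain ⟨i, hi⟩ := Function.ne_iff.mp hγ
    have hi : γ i ≠ 0 := hi
    set r := δ i / γ i with hr
    have hss : {s | δ s - r * γ s ≠ 0} ⊆ {s | δ s ≠ 0} := by
      intro s hs hds
      have : γ s = 0 := by
        by_contra h
        exact hsub h hds
      exact hs (by simp [hds, this])
    have hlt : {s | δ s - r * γ s ≠ 0} ⊂ {s | δ s ≠ 0} := by
      refine hss.ssubset_of_mem_notMem (hsub hi) ?_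
      simp [hr, hi]
    have h1 := ih _ (hn ▸ Set.ncard_lt_ncard hlt) (fun s => δ s - r * γ s)
      (by simp only [sub_smul, mul_smul, Finset.sum_sub_distrib, ← Finset.smul_sum, hδ, hγA,
            smul_zero, sub_zero])
      (hss.trans hF) rfl
    have h2 := hw γ hγA (hsub.trans hF) hc
    simpa only [sub_mul, mul_assoc, Finset.sum_sub_distrib, ← Finset.mul_sum, h2, mul_zero,
      sub_zero] using h1

/-- A weight that respects all linear dependences of a family is induced by a functional. -/
lemma exists_functional_of_dependences {S E : Type*} [Fintype S] [AddCommGroup E] [Module ℝ E]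
    (A : S → E) (w : S → ℝ)
    (hw : ∀ δ : S → ℝ, ∑ s, δ s • A s = 0 → ∑ s, δ s * w s = 0) :
    ∃ h : E →ₗ[ℝ] ℝ, ∀ s, h (A s) = w s := by
  classical
  have hmem : Fintype.linearCombination ℝ w ∈
      LinearMap.range (Fintype.linearCombination ℝ A).dualMap := by
    rw [LinearMap.range_dualMap_eq_dualAnnihilator_ker, Submodule.mem_dualAnnihilator]
    intro δ hδ
    simpa [Fintype.linearCombination_apply] using
      hw δ (by simpa [Fintype.linearCombination_apply] using hδ)
  obtain ⟨h, hh⟩ := hmem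
  refine ⟨h, fun s => ?_⟩
  simpa using LinearMap.congr_fun hh (Pi.single s 1)

/-- A weight on `F` that respects the circuits inside `F` is induced by a functional. -/
lemma exists_functional_of_circuits {S E : Type*} [Fintype S] [AddCommGroup E] [Module ℝ E]
    (A : S → E) (F : Set S) (w : S → ℝ)
    (hw : ∀ γ : S → ℝ, ∑ s, γ s • A s = 0 → {s | γ s ≠ 0} ⊆ F →
      IsCircuitSupport A {s | γ s ≠ 0} → ∑ s, γ s * w s = 0) :
    ∃ h : E →ₗ[ℝ] ℝ, ∀ s ∈ F, h (A s) = w s := by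
  classical
  obtain ⟨h, hh⟩ := exists_functional_of_dependences (F.indicator A) (F.indicator w) (by
    intro δ hδ
    have key := sum_mul_eq_zero_of_circuits A F w hw (F.indicator δ)
    simp only [Set.indicator_apply, smul_ite, smul_zero, ite_smul, zero_smul, mul_ite, mul_zero,
      ite_mul, zero_mul] at hδ key ⊢
    exact key hδ fun s hs => by
      by_contra hsF
      exact hs (if_neg hsF))
  exact ⟨h, fun s hs => by simpa [hs] using hh s⟩

/-- A functional that is nonnegative on the face `F` cuts out a face of `A` inside `F`. -/
lemma IsFaceOf.of_subface {S E : Type*} [Finite S] [AddCommGroup E] [Module ℝ E]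
    {A : S → E} {F H : Set S} (hF : IsFaceOf A F) (hHF : H ⊆ F) (h : E →ₗ[ℝ] ℝ)
    (h0 : ∀ s ∈ H, h (A s) = 0) (hpos : ∀ s ∈ F \ H, 0 < h (A s)) : IsFaceOf A H := by
  obtain ⟨f, hf0, hfpos⟩ := hF
  have hev : ∀ᶠ M : ℝ in Filter.atTop, ∀ s, s ∉ F → 0 < h (A s) + M * f (A s) := by
    refine Filter.eventually_all.mpr fun s => ?_
    by_cases hs : s ∈ F
    · exact Filter.Eventually.of_forall fun _ h => absurd hs h
    · filter_upwards [(Filter.tendsto_atTop_add_const_left _ (h (A s))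
        (Filter.tendsto_id.atTop_mul_const (hfpos s hs))).eventually_gt_atTop 0] with M hM _
      exact hM
  obtain ⟨M, hM⟩ := hev.exists
  refine ⟨h + M • f, fun s hs => by simp [h0 s hs, hf0 s (hHF hs)], fun s hs => ?_⟩
  by_cases hsF : s ∈ F
  · simpa [hf0 s hsF] using hpos s ⟨hsF, hs⟩
  · simpa using hM s hsF

lemma IsFaceOf.inter {S E : Type*} [AddCommGroup E] [Module ℝ E] {A : S → E} {F G : Set S}
    (hF : IsFaceOf A F) (hG : IsFaceOf A G) : IsFaceOf A (F ∩ G) := by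
  obtain ⟨f, hf0, hfpos⟩ := hF
  obtain ⟨g, hg0, hgpos⟩ := hG
  refine ⟨f + g, fun s hs => by simp [hf0 s hs.1, hg0 s hs.2], fun s hs => ?_⟩
  rw [LinearMap.add_apply]
  by_cases h1 : s ∈ F <;> by_cases h2 : s ∈ G
  · exact absurd ⟨h1, h2⟩ hs
  · rw [hf0 s h1, zero_add]
    exact hgpos s h2
  · rw [hg0 s h2, add_zero]
    exact hfpos s h1
  · exact add_pos (hfpos s h1) (hgpos s h2)

lemma exists_facialMaxBelow_superset {S : Type*} [Finite S] {C : Set (Set S)} {F c : Set S}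
    (hc : c ∈ C) (hcF : c ⊆ F) : ∃ G ∈ facialMaxBelow C F, c ⊆ G := by
  obtain ⟨G, hcG, hG⟩ := (Set.toFinite {b | b ∈ C ∧ b ⊆ F}).exists_le_maximal ⟨hc, hcF⟩
  exact ⟨G, ⟨hG.1.1, hG.1.2, fun H hH hHF hGH => hGH.antisymm (hG.2 ⟨hH, hHF⟩ hGH)⟩, hcG⟩

lemma IsBoolBuilding.eq_of_mem_facialMaxBelow {S : Type*} {C : Set (Set S)}
    (hC : IsBoolBuilding C) {F G H : Set S} (hG : G ∈ facialMaxBelow C F)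
    (hH : H ∈ facialMaxBelow C F) {s : S} (hsG : s ∈ G) (hsH : s ∈ H) : G = H := by
  have hU := hC.2.2 G hG.1 H hH.1 ⟨s, hsG, hsH⟩
  have hUF := Set.union_subset hG.2.1 hH.2.1
  rw [hG.2.2 _ hU hUF Set.subset_union_left]
  exact (hH.2.2 _ hU hUF Set.subset_union_right).symm

/-- Subsets of the maximal blocks below a face `F`, each cut out of its block by a functional,
have a face as their union. -/
lemma IsOrientedBuilding.isFaceOf_iUnion {S E : Type*} [Fintype S] [AddCommGroup E] [Module ℝ E]
    {A : S → E} {B : Set (Set S)} (hB : IsOrientedBuilding A B) {F : Set S} (hF : IsFaceOf A F)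
    (t : facialMaxBelow B F → Set S) (ht : ∀ G, t G ⊆ (G : Set S))
    (hu : ∀ G : facialMaxBelow B F, ∃ u : E →ₗ[ℝ] ℝ, (∀ s ∈ t G, u (A s) = 0) ∧
      ∀ s ∈ (G : Set S) \ t G, 0 < u (A s)) :
    IsFaceOf A (⋃ G, t G) := by
  choose u hu0 hupos using hu
  have hblock : ∀ s ∈ F, ∃ G : facialMaxBelow B F, s ∈ (G : Set S) := fun s hs => by
    obtain ⟨G, hG, hsG⟩ := exists_facialMaxBelow_superset (F := F) (hB.1.2.1 s) (by simpa using hs)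
    exact ⟨⟨G, hG⟩, by simpa using hsG⟩
  have hweight : ∀ s, ∃ r : ℝ, ∀ G : facialMaxBelow B F, s ∈ (G : Set S) → r = u G (A s) := by
    intro s
    by_cases h : ∃ G : facialMaxBelow B F, s ∈ (G : Set S)
    · obtain ⟨G, hsG⟩ := h
      refine ⟨u G (A s), fun G' hsG' => ?_⟩
      rw [Subtype.ext (hB.1.eq_of_mem_facialMaxBelow G.2 G'.2 hsG hsG')]
    · exact ⟨0, fun G hsG => absurd ⟨G, hsG⟩ h⟩
  choose w hw using hweight
  obtain ⟨h, hh⟩ := exists_functional_of_circuits A F w (by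
    intro γ hγ hγF hc
    obtain ⟨G, hG, hcG⟩ := exists_facialMaxBelow_superset (hB.2 _ hc) hγF
    have hterm : ∀ s, γ s * w s = u ⟨G, hG⟩ (γ s • A s) := fun s => by
      by_cases hs : γ s = 0
      · simp [hs]
      · rw [hw s ⟨G, hG⟩ (hcG hs), map_smul, smul_eq_mul]
    rw [Finset.sum_congr rfl fun s _ => hterm s, ← map_sum, hγ, map_zero])
  refine hF.of_subface (Set.iUnion_subset fun G => (ht G).trans G.2.2.1) h ?_ ?_
  · intro s hs
    obtain ⟨G, hsG⟩ := Set.mem_iUnion.mp hs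
    rw [hh s (G.2.2.1 (ht G hsG)), hw s G (ht G hsG)]
    exact hu0 G s hsG
  · rintro s ⟨hsF, hs⟩
    obtain ⟨G, hsG⟩ := hblock s hsF
    rw [hh s hsF, hw s G hsG]
    exact hupos G s ⟨hsG, fun hst => hs (Set.mem_iUnion.mpr ⟨G, hst⟩)⟩

/-- For an acyclic family, the maximal blocks below a face are faces. -/
lemma IsOrientedBuilding.isFaceOf_of_mem_facialMaxBelow {S E : Type*} [Fintype S]
    [AddCommGroup E] [Module ℝ E] {A : S → E} (hacyc : IsFaceOf A (∅ : Set S))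
    {B : Set (Set S)} (hB : IsOrientedBuilding A B) {F : Set S} (hF : IsFaceOf A F)
    {G : Set S} (hG : G ∈ facialMaxBelow B F) : IsFaceOf A G := by
  classical
  obtain ⟨g, -, hg⟩ := hacyc
  have key := hB.isFaceOf_iUnion hF (fun H => if (H : Set S) = G then G else ∅)
    (fun H => by
      split_ifs with h
      · exact h.ge
      · exact Set.empty_subset _)
    (fun H => by
      by_cases h : (H : Set S) = G
      · exact ⟨0, by simp, by simp [h]⟩
      · exact ⟨g, by simp [h], fun s _ => hg s (Set.notMem_empty s)⟩)
  convert key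
  ext s
  simp [hG]

lemma IsOrientedBuilding.facialMaxBelow_facial_part {S E : Type*} [Fintype S]
    [AddCommGroup E] [Module ℝ E] {A : S → E} (hacyc : IsFaceOf A (∅ : Set S))
    {B : Set (Set S)} (hB : IsOrientedBuilding A B) {F : Set S} (hF : IsFaceOf A F) :
    facialMaxBelow {b | b ∈ B ∧ IsFaceOf A b} F = facialMaxBelow B F := by
  ext G
  constructor
  · rintro ⟨⟨hGB, -⟩, hGF, hmax⟩
    obtain ⟨G', hG', hsub⟩ := exists_facialMaxBelow_superset hGB hGF
    rwa [hmax G' ⟨hG'.1, hB.isFaceOf_of_mem_facialMaxBelow hacyc hF hG'⟩ hG'.2.1 hsub]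
  · intro hG
    exact ⟨⟨hG.1, hB.isFaceOf_of_mem_facialMaxBelow hacyc hF hG⟩, hG.2.1,
      fun H hH => hG.2.2 H hH.1⟩

/-- **The facial part of an oriented building set is a facial building set** (part of the
surjectivity theorem). For a finite acyclic family `A` of vectors of a finite-dimensional real
inner product space and an oriented building set `B` for `A`, the collection
`{b ∈ B : b is a face of A}` is a facial building set for `A`. -/
theorem facial_part_isFacialBuilding {S E : Type*} [NormedAddCommGroup E]
    [InnerProductSpace ℝ E] [FiniteDimensional ℝ E] [Fintype S]
    (A : S → E) (hacyc : IsFaceOf A (∅ : Set S))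
    (B : Set (Set S)) (hB : IsOrientedBuilding A B) :
    IsFacialBuilding A {b | b ∈ B ∧ IsFaceOf A b} := by
  refine ⟨fun G hG => ⟨hG.2, hB.1.1 G hG.1⟩, fun F hF _ => ?_⟩
  rw [hB.facialMaxBelow_facial_part hacyc hF]
  have hdisj : ∀ (t : facialMaxBelow B F → Set S), (∀ G, t G ⊆ (G : Set S)) →
      ∀ G : facialMaxBelow B F, (⋃ G', t G') ∩ (G : Set S) = t G := fun t ht G => by
    ext s
    refine ⟨fun ⟨hs, hsG⟩ => ?_, fun hs => ⟨Set.mem_iUnion.mpr ⟨G, hs⟩, ht G hs⟩⟩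
    obtain ⟨G', hs'⟩ := Set.mem_iUnion.mp hs
    rwa [← Subtype.ext (hB.1.eq_of_mem_facialMaxBelow G'.2 G.2 (ht G' hs') hsG)]
  have hcover : ∀ H ⊆ F, (⋃ G : facialMaxBelow B F, H ∩ (G : Set S)) = H := fun H hH => by
    refine (Set.iUnion_subset fun G => Set.inter_subset_left).antisymm fun s hs => ?_
    obtain ⟨G, hG, hsG⟩ := exists_facialMaxBelow_superset (F := F) (hB.1.2.1 s)
      (by simpa using hH hs)
    exact Set.mem_iUnion.mpr ⟨⟨G, hG⟩, hs, hsG rfl⟩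
  refine ⟨{
    toFun := fun t => ⟨⋃ G, t.1 G, hB.isFaceOf_iUnion hF t.1 (fun G => (t.2 G).2) (fun G => by
        obtain ⟨u, hu0, hupos⟩ := (t.2 G).1
        exact ⟨u, hu0, fun s hs => hupos s hs.2⟩),
      Set.iUnion_subset fun G => (t.2 G).2.trans G.2.2.1⟩
    invFun := fun H => ⟨fun G => H.1 ∩ G, fun G =>
      ⟨H.2.1.inter (hB.isFaceOf_of_mem_facialMaxBelow hacyc hF G.2), Set.inter_subset_right⟩⟩
    left_inv := fun t => Subtype.ext (funext fun G => hdisj t.1 (fun G => (t.2 G).2) G)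
    right_inv := fun H => Subtype.ext (hcover H.1 H.2.2)
    map_rel_iff' := ?_ }, ?_⟩
  · intro t t'
    refine ⟨fun h G => ?_, fun h => Set.iUnion_mono h⟩
    have h' : (⋃ G, t.1 G) ⊆ ⋃ G, t'.1 G := h
    rw [← hdisj t.1 (fun G => (t.2 G).2) G, ← hdisj t'.1 (fun G => (t'.2 G).2) G]
    exact Set.inter_subset_inter_left _ h'
  · intro t G hG
    change (⋃ G', t.1 G') = t.1 G
    refine (Set.iUnion_subset fun G' => ?_).antisymm (Set.subset_iUnion t.1 G)
    by_cases h : G' = G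
    · rw [h]
    · rw [hG G' h]
      exact Set.empty_subset _
end
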